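/- There exists an absolute constant N₁ > 0 such that for every ν > 0 and every integer N with N₁ ≤ N ≤ 1/(2√3 π ν), one has c₁ log N ≤ ‖K_N‖_{L¹(𝕋)} ≤ c₂ log N and c₁ log N ≤ ‖K_{>N}‖_{L¹(𝕋)} ≤ c₂ log N, where c₁ > 0 and c₂ > 0 are absolute constants. -/

import Mathlib

open MeasureTheory

noncomputable section

/-- The character `e^{2πit}`. -/
def e1 (t : ℝ) : ℂ := Complex.exp (2 * Real.pi * Complex.I * t)

/-- The truncated kernel `K_N(x) = ∑_{|k| ≤ N} (1 + 4π²ν²k²)⁻¹ e^{2πikx}` on `𝕋`. -/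
def KNker (ν : ℝ) (N : ℕ) (x : ℝ) : ℂ :=
  ∑ k ∈ Finset.Icc (-(N : ℤ)) (N : ℤ),
    (((1 + 4 * Real.pi ^ 2 * ν ^ 2 * (k : ℝ) ^ 2)⁻¹ : ℝ) : ℂ) * e1 ((k : ℝ) * x)

lemma e1_add (s t : ℝ) : e1 (s + t) = e1 s * e1 t := by
  simp only [e1]
  rw [← Complex.exp_add]
  push_cast
  ring_nf

lemma norm_e1 (t : ℝ) : ‖e1 t‖ = 1 := by
  have h : e1 t = Complex.exp ((2 * Real.pi * t : ℝ) * Complex.I) := by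
    simp only [e1]
    push_cast
    ring_nf
  rw [h, Complex.norm_exp_ofReal_mul_I]

lemma e1_intCast (k : ℤ) : e1 (k : ℝ) = 1 := by
  rw [e1, Complex.exp_eq_one_iff]
  exact ⟨k, by push_cast; ring⟩

@[fun_prop]
lemma continuous_e1 : Continuous e1 := by
  unfold e1
  fun_prop

/-- The Fourier coefficient `(1 + 4π²ν²k²)⁻¹`. -/
def mult (ν : ℝ) (k : ℤ) : ℝ := (1 + 4 * Real.pi ^ 2 * ν ^ 2 * (k : ℝ) ^ 2)⁻¹

lemma mult_pos (ν : ℝ) (k : ℤ) : 0 < mult ν k := by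
  unfold mult
  positivity

lemma mult_le_one (ν : ℝ) (k : ℤ) : mult ν k ≤ 1 := by
  unfold mult
  exact inv_le_one_of_one_le₀ (le_add_of_nonneg_right (by positivity))

lemma mult_succ_le (ν : ℝ) (n : ℕ) : mult ν (n + 1 : ℕ) ≤ mult ν n := by
  unfold mult
  push_cast
  gcongr
  linarith

lemma KNker_eq (ν : ℝ) (N : ℕ) (x : ℝ) :
    KNker ν N x = ∑ k ∈ Finset.Icc (-(N : ℤ)) N, (mult ν k : ℂ) * e1 (k * x) := rfl

@[fun_prop]
lemma continuous_KNker (ν : ℝ) (N : ℕ) : Continuous (KNker ν N) := by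
  unfold KNker
  fun_prop

lemma KNker_add_one (ν : ℝ) (N : ℕ) (x : ℝ) : KNker ν N (x + 1) = KNker ν N x := by
  simp only [KNker_eq, mul_add, e1_add, mul_one, e1_intCast]

lemma KNker_zero (ν x : ℝ) : KNker ν 0 x = 1 := by
  simp [KNker, e1]

lemma KNker_succ (ν : ℝ) (N : ℕ) (x : ℝ) :
    KNker ν (N + 1) x = KNker ν N x
      + mult ν (N + 1 : ℕ) * (e1 ((N + 1) * x) + e1 (-(N + 1) * x)) := by
  have h : Finset.Icc (-((N + 1 : ℕ) : ℤ)) ((N + 1 : ℕ) : ℤ)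
      = insert (-((N + 1 : ℕ) : ℤ)) (insert ((N + 1 : ℕ) : ℤ) (Finset.Icc (-(N : ℤ)) N)) := by
    ext k
    simp only [Finset.mem_Icc, Finset.mem_insert]
    omega
  rw [KNker_eq, KNker_eq, h, Finset.sum_insert, Finset.sum_insert]
  · simp only [mult]
    push_cast
    rw [neg_sq]
    ring
  · simp
  · simp only [Finset.mem_Icc, Finset.mem_insert]
    omega

lemma norm_KNker_le (ν : ℝ) (N : ℕ) (x : ℝ) : ‖KNker ν N x‖ ≤ 2 * N + 1 := by
  rw [KNker_eq]
  refine (norm_sum_le_of_le (f := fun k : ℤ => (mult ν k : ℂ) * e1 (k * x)) _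
    (n := fun _ => (1 : ℝ)) fun k _ => ?_).trans (le_of_eq ?_)
  · rw [norm_mul, norm_e1, mul_one, Complex.norm_real, Real.norm_of_nonneg (mult_pos ν k).le]
    exact mult_le_one ν k
  · rw [Finset.sum_const, Int.card_Icc, nsmul_one]
    have : ((N : ℤ) + 1 - -(N : ℤ)).toNat = 2 * N + 1 := by omega
    rw [this]
    push_cast
    ring

/-- `KNker 0` is the Dirichlet kernel. -/
lemma e1_sub_one_mul_dirichlet (N : ℕ) (x : ℝ) :
    (e1 x - 1) * KNker 0 N x = e1 ((N + 1) * x) - e1 (-N * x) := by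
  induction N with
  | zero => simp [KNker_zero, e1]
  | succ N ih =>
    rw [KNker_succ, mul_add, ih]
    have h1 : e1 ((((N + 1 : ℕ) : ℝ) + 1) * x) = e1 x * e1 ((N + 1) * x) := by
      rw [← e1_add]; push_cast; ring_nf
    have h2 : e1 (-N * x) = e1 x * e1 (-(N + 1) * x) := by
      rw [← e1_add]; ring_nf
    rw [h1, h2]
    simp [mult]
    ring

lemma norm_e1_sub_one_mul_dirichlet_le (N : ℕ) (x : ℝ) :
    ‖(e1 x - 1) * KNker 0 N x‖ ≤ 2 := by
  rw [e1_sub_one_mul_dirichlet]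
  refine (norm_sub_le _ _).trans ?_
  rw [norm_e1, norm_e1]
  norm_num

/-- Summation by parts. -/
lemma norm_e1_sub_one_mul_sub_le (ν : ℝ) (N : ℕ) (x : ℝ) :
    ‖(e1 x - 1) * (KNker ν N x - mult ν N * KNker 0 N x)‖ ≤ 2 * (1 - mult ν N) := by
  induction N with
  | zero => simp [KNker_zero, mult]
  | succ N ih =>
    have h : (e1 x - 1) * (KNker ν (N + 1) x - mult ν (N + 1 : ℕ) * KNker 0 (N + 1) x)
        = (e1 x - 1) * (KNker ν N x - mult ν N * KNker 0 N x)
          + ((mult ν N - mult ν (N + 1 : ℕ) : ℝ) : ℂ) * ((e1 x - 1) * KNker 0 N x) := by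
      have h0 : mult 0 (N + 1 : ℕ) = 1 := by simp [mult]
      rw [KNker_succ, KNker_succ, h0]
      push_cast
      ring
    rw [h]
    refine (norm_add_le _ _).trans ?_
    have hd := sub_nonneg.2 (mult_succ_le ν N)
    rw [norm_mul (((_ : ℝ) : ℂ)), Complex.norm_real, Real.norm_of_nonneg hd]
    have := mul_le_mul_of_nonneg_left (norm_e1_sub_one_mul_dirichlet_le N x) hd
    linarith

lemma norm_e1_sub_one_mul_KNker_le (ν : ℝ) (N : ℕ) (x : ℝ) :
    ‖e1 x - 1‖ * ‖KNker ν N x‖ ≤ 2 := by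
  have h : (e1 x - 1) * KNker ν N x
      = (e1 x - 1) * (KNker ν N x - mult ν N * KNker 0 N x)
        + (mult ν N : ℂ) * ((e1 x - 1) * KNker 0 N x) := by ring
  rw [← norm_mul, h]
  refine (norm_add_le _ _).trans ?_
  rw [norm_mul (((_ : ℝ) : ℂ)), Complex.norm_real, Real.norm_of_nonneg (mult_pos ν N).le]
  have h1 := norm_e1_sub_one_mul_sub_le ν N x
  have h2 := mul_le_mul_of_nonneg_left (norm_e1_sub_one_mul_dirichlet_le N x) (mult_pos ν N).le
  linarith

lemma norm_e1_sub_one (x : ℝ) : ‖e1 x - 1‖ = 2 * |Real.sin (Real.pi * x)| := by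
  have h : e1 x = Complex.exp (Complex.I * (2 * Real.pi * x : ℝ)) := by
    simp only [e1]
    push_cast
    ring_nf
  rw [h, Complex.norm_exp_I_mul_ofReal_sub_one, norm_mul, Real.norm_eq_abs, Real.norm_eq_abs,
    abs_two, show 2 * Real.pi * x / 2 = Real.pi * x by ring]

lemma two_mul_le_sin_pi_mul {x : ℝ} (h0 : 0 ≤ x) (h1 : x ≤ 1 / 2) :
    2 * x ≤ Real.sin (Real.pi * x) := by
  have hπ := Real.pi_pos
  have := Real.mul_le_sin (x := Real.pi * x) (by positivity) (by nlinarith)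
  rwa [← mul_assoc, div_mul_cancel₀ _ hπ.ne'] at this

lemma norm_KNker_le_add (ν : ℝ) (N : ℕ) {x : ℝ} (h0 : 0 ≤ x) (h1 : x ≤ 1) :
    ‖KNker ν N x‖ ≤ 2 / ((2 * N + 1 : ℝ)⁻¹ + 2 * x) + 2 / ((2 * N + 1 : ℝ)⁻¹ + 2 * (1 - x)) := by
  have hM : (0 : ℝ) < 2 * N + 1 := by positivity
  have hA : ‖KNker ν N x‖ * (2 * N + 1 : ℝ)⁻¹ ≤ 1 := by
    rw [← div_eq_mul_inv, div_le_one hM]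
    exact norm_KNker_le ν N x
  have hB := norm_e1_sub_one_mul_KNker_le ν N x
  rw [norm_e1_sub_one] at hB
  have hK := norm_nonneg (KNker ν N x)
  have hi := inv_pos.2 hM
  have key : ∀ y : ℝ, 0 ≤ y → 2 * y ≤ |Real.sin (Real.pi * x)| →
      ‖KNker ν N x‖ ≤ 2 / ((2 * N + 1 : ℝ)⁻¹ + 2 * y) := by
    intro y hy h
    rw [le_div_iff₀ (by positivity)]
    have := mul_le_mul_of_nonneg_right h hK
    linarith
  rcases le_total x (1 / 2) with hx | hx
  · refine (key x h0 ((two_mul_le_sin_pi_mul h0 hx).trans (le_abs_self _))).trans ?_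
    exact le_add_of_nonneg_right (div_nonneg zero_le_two (by linarith))
  · refine (key (1 - x) (by linarith) ?_).trans
      (le_add_of_nonneg_left (div_nonneg zero_le_two (by linarith)))
    have := two_mul_le_sin_pi_mul (x := 1 - x) (by linarith) (by linarith)
    rw [mul_sub Real.pi, mul_one, Real.sin_pi_sub] at this
    exact this.trans (le_abs_self _)

lemma setIntegral_Ico_eq {E : Type*} [NormedAddCommGroup E] [NormedSpace ℝ E] (f : ℝ → E) :
    ∫ x in Set.Ico (0 : ℝ) 1, f x = ∫ x in (0 : ℝ)..1, f x := by
  rw [intervalIntegral.integral_of_le zero_le_one, integral_Ico_eq_integral_Ioo,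
    integral_Ioc_eq_integral_Ioo]

lemma intervalIntegrable_two_div_add {δ : ℝ} (hδ : 0 < δ) :
    IntervalIntegrable (fun x : ℝ => 2 / (δ + 2 * x)) volume 0 1 := by
  apply ContinuousOn.intervalIntegrable
  intro x hx
  rw [Set.uIcc_of_le zero_le_one] at hx
  have hx0 := hx.1
  have : δ + 2 * x ≠ 0 := by positivity
  exact ContinuousAt.continuousWithinAt (by fun_prop (disch := assumption))

lemma integral_two_div_add {δ : ℝ} (hδ : 0 < δ) :
    ∫ x in (0 : ℝ)..1, 2 / (δ + 2 * x) = Real.log (1 + 2 * δ⁻¹) := by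
  have h : ∀ x ∈ Set.uIcc (0 : ℝ) 1,
      HasDerivAt (fun x => Real.log (δ + 2 * x)) (2 / (δ + 2 * x)) x := by
    intro x hx
    rw [Set.uIcc_of_le zero_le_one] at hx
    have hx0 := hx.1
    have h2 : HasDerivAt (fun x : ℝ => δ + 2 * x) 2 x := by
      simpa using ((hasDerivAt_id x).const_mul 2).const_add δ
    exact h2.log (by positivity)
  rw [intervalIntegral.integral_eq_sub_of_hasDerivAt h (intervalIntegrable_two_div_add hδ),
    ← Real.log_div (by positivity) (by positivity)]
  congr 1
  field_simp
  ring

lemma integral_norm_KNker_le (ν : ℝ) (N : ℕ) :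
    ∫ x in (0 : ℝ)..1, ‖KNker ν N x‖ ≤ 2 * Real.log (4 * N + 3) := by
  have hδ : (0 : ℝ) < (2 * N + 1 : ℝ)⁻¹ := by positivity
  have hint := intervalIntegrable_two_div_add hδ
  have hint' : IntervalIntegrable
      (fun x : ℝ => 2 / ((2 * N + 1 : ℝ)⁻¹ + 2 * (1 - x))) volume 0 1 := by
    simpa using (hint.comp_sub_left 1).symm
  have h := intervalIntegral.integral_mono_on zero_le_one
    (((continuous_KNker ν N).norm).intervalIntegrable 0 1) (hint.add hint')
    (fun x hx => norm_KNker_le_add ν N hx.1 hx.2)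
  refine h.trans (le_of_eq ?_)
  rw [intervalIntegral.integral_add hint hint',
    intervalIntegral.integral_comp_sub_left
      (fun x : ℝ => 2 / ((2 * N + 1 : ℝ)⁻¹ + 2 * x)) 1]
  rw [sub_self, sub_zero, integral_two_div_add hδ, inv_inv, ← two_mul]
  ring_nf

lemma e1_mul_eq_exp (k : ℤ) (x : ℝ) :
    e1 (k * x) = Complex.exp (2 * Real.pi * Complex.I * k * x) := by
  simp only [e1]
  push_cast
  ring_nf

lemma two_pi_I_mul_ne_zero {k : ℤ} (hk : k ≠ 0) : (2 * Real.pi * Complex.I * k : ℂ) ≠ 0 :=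
  mul_ne_zero Complex.two_pi_I_ne_zero (Int.cast_ne_zero.2 hk)

lemma integral_e1 (k : ℤ) : ∫ x in (0 : ℝ)..1, e1 (k * x) = if k = 0 then 1 else 0 := by
  split_ifs with hk
  · simp [hk, e1]
  · simp_rw [e1_mul_eq_exp]
    rw [integral_exp_mul_complex (two_pi_I_mul_ne_zero hk)]
    have h := e1_mul_eq_exp k 1
    rw [mul_one, e1_intCast] at h
    rw [← h]
    simp

lemma integral_half_sub_mul_e1 (k : ℤ) :
    ∫ x in (0 : ℝ)..1, (1 / 2 - x : ℂ) * e1 (k * x)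
      = Complex.I * ((2 * Real.pi)⁻¹ * (k : ℝ)⁻¹ : ℝ) := by
  rcases eq_or_ne k 0 with rfl | hk
  · have h : ∫ x in (0 : ℝ)..1, (1 / 2 - x : ℂ) = ((∫ x in (0 : ℝ)..1, (1 / 2 - x) : ℝ) : ℂ) := by
      rw [← intervalIntegral.integral_ofReal]
      push_cast
      rfl
    have h2 : ∫ x in (0 : ℝ)..1, ((1 : ℝ) / 2 - x) = 0 := by
      rw [intervalIntegral.integral_sub (by simp) (by simp)]
      simp
    rw [h2] at h
    simpa [e1] using h
  · set c : ℂ := 2 * Real.pi * Complex.I * k with hc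
    have hc0 : c ≠ 0 := two_pi_I_mul_ne_zero hk
    have hd : ∀ x ∈ Set.uIcc (0 : ℝ) 1,
        HasDerivAt (fun x : ℝ => ((1 / 2 - x) / c + 1 / c ^ 2) * Complex.exp (c * x))
          ((1 / 2 - x : ℂ) * e1 (k * x)) x := by
      intro x _
      have h1 : HasDerivAt (fun x : ℝ => (x : ℂ)) 1 x := Complex.ofRealCLM.hasDerivAt
      have h2 := ((h1.const_sub (1 / 2)).div_const c).add_const (1 / c ^ 2)
      have h3 := (h1.const_mul c).cexp
      refine (h2.mul h3).congr_deriv ?_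
      rw [e1_mul_eq_exp, ← hc]
      field_simp
      ring
    rw [intervalIntegral.integral_eq_sub_of_hasDerivAt hd
      (Continuous.intervalIntegrable (by fun_prop) _ _)]
    have h := e1_mul_eq_exp k 1
    rw [mul_one, e1_intCast, ← hc] at h
    rw [← h, Complex.ofReal_zero, mul_zero, Complex.exp_zero]
    have hk' : (k : ℂ) ≠ 0 := Int.cast_ne_zero.2 hk
    have hπ : (Real.pi : ℂ) ≠ 0 := Complex.ofReal_ne_zero.2 Real.pi_ne_zero
    rw [hc]
    push_cast
    field_simp
    ring_nf
    simp

lemma log_le_sum_inv (N : ℕ) :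
    Real.log N ≤ ∑ k ∈ Finset.Icc (-(N : ℤ)) N, ((N + k : ℤ) : ℝ)⁻¹ := by
  have h1 : Real.log N ≤ ∑ i ∈ Finset.range N, ((i + 1 : ℕ) : ℝ)⁻¹ := by
    have h := log_add_one_le_harmonic N
    rw [harmonic] at h
    push_cast at h ⊢
    refine le_trans ?_ h
    rcases Nat.eq_zero_or_pos N with rfl | hN
    · simp
    · exact Real.log_le_log (by exact_mod_cast hN) (by linarith)
  refine h1.trans ?_
  have hinj : Set.InjOn (fun i : ℕ => (i : ℤ) + 1 - N) (Finset.range N) := by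
    intro a _ b _ hab
    simp only at hab
    omega
  have h2 : ∑ i ∈ Finset.range N, ((i + 1 : ℕ) : ℝ)⁻¹
      = ∑ k ∈ (Finset.range N).image (fun i : ℕ => (i : ℤ) + 1 - N), ((N + k : ℤ) : ℝ)⁻¹ := by
    rw [Finset.sum_image hinj]
    refine Finset.sum_congr rfl fun i _ => ?_
    push_cast
    ring_nf
  rw [h2]
  refine Finset.sum_le_sum_of_subset_of_nonneg ?_ ?_
  · intro k hk
    simp only [Finset.mem_image, Finset.mem_range, Finset.mem_Icc] at hk ⊢
    omega
  · intro k hk _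
    rw [Finset.mem_Icc] at hk
    have : (0 : ℤ) ≤ N + k := by omega
    exact inv_nonneg.2 (by exact_mod_cast this)

/-- Pairing `e^{2πiNx} K_N(x)` with the sawtooth `1/2 - x`. -/
lemma integral_sawtooth_mul_KNker (ν : ℝ) (N : ℕ) :
    ∫ x in (0 : ℝ)..1, (1 / 2 - x : ℂ) * (e1 (N * x) * KNker ν N x)
      = Complex.I * ((2 * Real.pi)⁻¹ *
        ∑ k ∈ Finset.Icc (-(N : ℤ)) N, mult ν k * ((N + k : ℤ) : ℝ)⁻¹ : ℝ) := by
  have h : ∀ x : ℝ, (1 / 2 - x : ℂ) * (e1 (N * x) * KNker ν N x)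
      = ∑ k ∈ Finset.Icc (-(N : ℤ)) N,
        (mult ν k : ℂ) * ((1 / 2 - x : ℂ) * e1 ((N + k : ℤ) * x)) := by
    intro x
    rw [KNker_eq, Finset.mul_sum, Finset.mul_sum]
    refine Finset.sum_congr rfl fun k _ => ?_
    have : e1 ((N + k : ℤ) * x) = e1 (N * x) * e1 (k * x) := by
      rw [← e1_add]
      push_cast
      ring_nf
    rw [this]
    ring
  simp_rw [h]
  rw [intervalIntegral.integral_finsetSum
    fun k _ => Continuous.intervalIntegrable (by fun_prop) _ _]
  simp_rw [intervalIntegral.integral_const_mul, integral_half_sub_mul_e1]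
  push_cast
  rw [Finset.mul_sum, Finset.mul_sum]
  refine Finset.sum_congr rfl fun k _ => ?_
  ring

lemma le_integral_norm_KNker {ν : ℝ} {N : ℕ} {c : ℝ}
    (hc : ∀ k ∈ Finset.Icc (-(N : ℤ)) N, c ≤ mult ν k) (hc0 : 0 ≤ c) :
    Real.pi⁻¹ * (c * Real.log N) ≤ ∫ x in (0 : ℝ)..1, ‖KNker ν N x‖ := by
  have h1 : ‖∫ x in (0 : ℝ)..1, (1 / 2 - x : ℂ) * (e1 (N * x) * KNker ν N x)‖
      ≤ ∫ x in (0 : ℝ)..1, 1 / 2 * ‖KNker ν N x‖ := by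
    refine (intervalIntegral.norm_integral_le_integral_norm zero_le_one).trans ?_
    refine intervalIntegral.integral_mono_on zero_le_one
      (Continuous.intervalIntegrable (by fun_prop) _ _)
      (Continuous.intervalIntegrable (by fun_prop) _ _) fun x hx => ?_
    rw [norm_mul, norm_mul, norm_e1, one_mul]
    gcongr
    have : (1 / 2 - x : ℂ) = ((1 / 2 - x : ℝ) : ℂ) := by push_cast; rfl
    rw [this, Complex.norm_real, Real.norm_eq_abs, abs_le]
    constructor <;> linarith [hx.1, hx.2]
  rw [integral_sawtooth_mul_KNker, intervalIntegral.integral_const_mul, norm_mul, Complex.norm_I,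
    one_mul, Complex.norm_real] at h1
  have h2 : c * Real.log N ≤ ∑ k ∈ Finset.Icc (-(N : ℤ)) N, mult ν k * ((N + k : ℤ) : ℝ)⁻¹ := by
    refine (mul_le_mul_of_nonneg_left (log_le_sum_inv N) hc0).trans ?_
    rw [Finset.mul_sum]
    refine Finset.sum_le_sum fun k hk => mul_le_mul_of_nonneg_right (hc k hk) ?_
    rw [Finset.mem_Icc] at hk
    have : (0 : ℤ) ≤ N + k := by omega
    exact inv_nonneg.2 (by exact_mod_cast this)
  have h3 := (Real.le_norm_self _).trans h1
  have h4 := mul_le_mul_of_nonneg_left h2 (inv_nonneg.2 Real.pi_pos.le)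
  rw [mul_inv] at h3
  linarith

lemma integral_KNker_mul_e1 (ν : ℝ) (N : ℕ) (k : ℤ) :
    ∫ x in (0 : ℝ)..1, KNker ν N x * e1 (-k * x)
      = if |k| ≤ N then (mult ν k : ℂ) else 0 := by
  have h : ∀ x : ℝ, KNker ν N x * e1 (-k * x)
      = ∑ j ∈ Finset.Icc (-(N : ℤ)) N, (mult ν j : ℂ) * e1 ((j - k : ℤ) * x) := by
    intro x
    rw [KNker_eq, Finset.sum_mul]
    refine Finset.sum_congr rfl fun j _ => ?_
    rw [mul_assoc, ← e1_add]
    push_cast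
    ring_nf
  simp_rw [h]
  rw [intervalIntegral.integral_finsetSum
    fun k _ => Continuous.intervalIntegrable (by fun_prop) _ _]
  simp_rw [intervalIntegral.integral_const_mul, integral_e1, sub_eq_zero, mul_ite, mul_one,
    mul_zero]
  rw [Finset.sum_ite_eq']
  simp only [Finset.mem_Icc, abs_le]

/-- The periodic kernel with Fourier coefficients `mult ν k` for all `k ∈ ℤ`. -/
def fullKer (ν x : ℝ) : ℝ :=
  Real.cosh (ν⁻¹ * (Int.fract x - 1 / 2)) / (2 * ν * Real.sinh (ν⁻¹ / 2))

lemma fullKer_add_one (ν x : ℝ) : fullKer ν (x + 1) = fullKer ν x := by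
  simp [fullKer]

lemma fullKer_nonneg {ν : ℝ} (hν : 0 < ν) (x : ℝ) : 0 ≤ fullKer ν x := by
  have : 0 < Real.sinh (ν⁻¹ / 2) := Real.sinh_pos_iff.2 (by positivity)
  have := Real.cosh_pos (ν⁻¹ * (Int.fract x - 1 / 2))
  unfold fullKer
  positivity

lemma fullKer_of_mem {ν x : ℝ} (hx : x ∈ Set.Ico (0 : ℝ) 1) :
    fullKer ν x = Real.cosh (ν⁻¹ * (x - 1 / 2)) / (2 * ν * Real.sinh (ν⁻¹ / 2)) := by
  rw [fullKer, Int.fract_eq_self.2 hx]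

lemma integrableOn_fullKer (ν : ℝ) : IntegrableOn (fullKer ν) (Set.Ico (0 : ℝ) 1) := by
  have h : Continuous fun x : ℝ =>
      Real.cosh (ν⁻¹ * (x - 1 / 2)) / (2 * ν * Real.sinh (ν⁻¹ / 2)) := by fun_prop
  exact (h.integrableOn_Icc.mono_set Set.Ico_subset_Icc_self).congr_fun
    (fun x hx => (fullKer_of_mem hx).symm) measurableSet_Ico

lemma integral_exp_mul_e1 {s : ℝ} (hs : s ≠ 0) (k : ℤ) :
    ∫ x in (0 : ℝ)..1, Complex.exp (s * (x - 1 / 2)) * e1 (-k * x)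
      = (2 * Complex.sinh (s / 2)) / (s - 2 * Real.pi * Complex.I * k) := by
  have hc : (s - 2 * Real.pi * Complex.I * k : ℂ) ≠ 0 := by
    intro h
    have := congrArg Complex.re h
    simp at this
    exact hs this
  have h : ∀ x : ℝ, Complex.exp (s * (x - 1 / 2)) * e1 (-k * x)
      = Complex.exp (-(s / 2)) * Complex.exp ((s - 2 * Real.pi * Complex.I * k) * x) := by
    intro x
    rw [e1, ← Complex.exp_add, ← Complex.exp_add]
    push_cast
    ring_nf
  simp_rw [h]
  rw [intervalIntegral.integral_const_mul, integral_exp_mul_complex hc, Complex.two_sinh]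
  have h1 : Complex.exp ((s - 2 * Real.pi * Complex.I * k) * (1 : ℝ)) = Complex.exp s := by
    have h2 := e1_mul_eq_exp (-k) 1
    rw [mul_one, e1_intCast] at h2
    rw [Complex.ofReal_one, mul_one, sub_eq_add_neg, Complex.exp_add]
    have h3 : -(2 * Real.pi * Complex.I * k : ℂ)
        = 2 * Real.pi * Complex.I * ((-k : ℤ) : ℂ) * (1 : ℝ) := by push_cast; ring
    rw [h3, ← h2, mul_one]
  rw [h1, Complex.ofReal_zero, mul_zero, Complex.exp_zero, ← mul_div_assoc, mul_sub,
    ← Complex.exp_add, mul_one]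
  ring_nf

lemma integral_fullKer_mul_e1 {ν : ℝ} (hν : 0 < ν) (k : ℤ) :
    ∫ x in Set.Ico (0 : ℝ) 1, (fullKer ν x : ℂ) * e1 (-k * x) = mult ν k := by
  have hs : ν⁻¹ ≠ 0 := inv_ne_zero hν.ne'
  have hsinh : Complex.sinh ((ν⁻¹ : ℝ) / 2) ≠ 0 := by
    have h : (0 : ℝ) < Real.sinh (ν⁻¹ / 2) := Real.sinh_pos_iff.2 (by positivity)
    have := Complex.ofReal_ne_zero.2 h.ne'
    push_cast at this ⊢
    exact this
  have hν' : (ν : ℂ) ≠ 0 := Complex.ofReal_ne_zero.2 hν.ne'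
  have h : ∫ x in Set.Ico (0 : ℝ) 1, (fullKer ν x : ℂ) * e1 (-k * x)
      = ∫ x in Set.Ico (0 : ℝ) 1, (4 * ν * Complex.sinh ((ν⁻¹ : ℝ) / 2))⁻¹ *
        (Complex.exp ((ν⁻¹ : ℝ) * (x - 1 / 2)) * e1 (-k * x)
          + Complex.exp ((-ν⁻¹ : ℝ) * (x - 1 / 2)) * e1 (-k * x)) := by
    refine setIntegral_congr_fun measurableSet_Ico fun x hx => ?_
    simp only [fullKer_of_mem hx]
    push_cast at hsinh ⊢
    simp only [Complex.cosh, neg_mul]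
    generalize Complex.sinh ((ν : ℂ)⁻¹ / 2) = S at *
    generalize Complex.exp ((ν : ℂ)⁻¹ * (x - 1 / 2)) = A
    generalize Complex.exp (-((ν : ℂ)⁻¹ * (x - 1 / 2))) = B
    field_simp
    ring
  rw [h, setIntegral_Ico_eq, intervalIntegral.integral_const_mul,
    intervalIntegral.integral_add (Continuous.intervalIntegrable (by fun_prop) _ _)
      (Continuous.intervalIntegrable (by fun_prop) _ _),
    integral_exp_mul_e1 hs, integral_exp_mul_e1 (neg_ne_zero.2 hs)]
  have hn : ((-ν⁻¹ : ℝ) : ℂ) / 2 = -(((ν⁻¹ : ℝ) : ℂ) / 2) := by push_cast; ring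
  rw [hn, Complex.sinh_neg]
  generalize Complex.sinh ((ν⁻¹ : ℝ) / 2) = S at *
  have key : ∀ t : ℝ, (1 + t * Complex.I : ℂ) ≠ 0 := by
    intro t h
    simpa using congrArg Complex.re h
  have hsub : (1 - 2 * Real.pi * Complex.I * k * ν : ℂ) ≠ 0 := by
    have := key (-(2 * Real.pi * k * ν))
    push_cast at this
    convert this using 1
    ring
  have hadd : (1 + 2 * Real.pi * Complex.I * k * ν : ℂ) ≠ 0 := by
    have := key (2 * Real.pi * k * ν)
    push_cast at this
    convert this using 1
    ring
  have hpos : (((ν⁻¹ : ℝ) : ℂ) - 2 * Real.pi * Complex.I * k)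
      = (1 - 2 * Real.pi * Complex.I * k * ν) / ν := by
    push_cast; field_simp
  have hneg : (((-ν⁻¹ : ℝ) : ℂ) - 2 * Real.pi * Complex.I * k)
      = -(1 + 2 * Real.pi * Complex.I * k * ν) / ν := by
    push_cast; field_simp; ring
  have hmult : (mult ν k : ℂ)
      = ((1 - 2 * Real.pi * Complex.I * k * ν) * (1 + 2 * Real.pi * Complex.I * k * ν))⁻¹ := by
    rw [mult]
    push_cast
    congr 1
    linear_combination (4 * Real.pi ^ 2 * k ^ 2 * ν ^ 2 : ℂ) * Complex.I_sq
  rw [hpos, hneg, hmult]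
  have hsum : (1 - 2 * Real.pi * Complex.I * k * ν : ℂ)
      + (1 + 2 * Real.pi * Complex.I * k * ν) = 2 := by ring
  generalize (1 - 2 * Real.pi * Complex.I * k * ν : ℂ) = P at *
  generalize (1 + 2 * Real.pi * Complex.I * k * ν : ℂ) = Q at *
  field_simp
  linear_combination 2 * hsum

lemma integral_norm_fullKer {ν : ℝ} (hν : 0 < ν) :
    ∫ x in Set.Ico (0 : ℝ) 1, ‖(fullKer ν x : ℂ)‖ = 1 := by
  have h := integral_fullKer_mul_e1 hν 0
  simp only [Complex.norm_real, Real.norm_of_nonneg (fullKer_nonneg hν _)]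
  simp only [Int.cast_zero, neg_zero, zero_mul, e1, Complex.ofReal_zero, mul_zero,
    Complex.exp_zero, mul_one, mult] at h
  rw [integral_complex_ofReal] at h
  simpa using Complex.ofReal_injective h

lemma three_quarters_le_mult {ν : ℝ} (hν : 0 < ν) {N : ℕ}
    (hN : (N : ℝ) ≤ 1 / (2 * Real.sqrt 3 * Real.pi * ν)) {k : ℤ}
    (hk : k ∈ Finset.Icc (-(N : ℤ)) N) : 3 / 4 ≤ mult ν k := by
  have hπ := Real.pi_pos
  rw [Finset.mem_Icc] at hk
  have hk2 : (k : ℝ) ^ 2 ≤ (N : ℝ) ^ 2 :=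
    sq_le_sq' (by exact_mod_cast hk.1) (by exact_mod_cast hk.2)
  rw [le_div_iff₀ (by positivity)] at hN
  have h1 : ((N : ℝ) * (2 * Real.sqrt 3 * Real.pi * ν)) ^ 2 ≤ 1 :=
    pow_le_one₀ (by positivity) hN
  have h2 : 4 * Real.pi ^ 2 * ν ^ 2 * (k : ℝ) ^ 2 ≤ 4 * Real.pi ^ 2 * ν ^ 2 * (N : ℝ) ^ 2 := by
    gcongr
  have h3 : ((N : ℝ) * (2 * Real.sqrt 3 * Real.pi * ν)) ^ 2
      = 3 * (4 * Real.pi ^ 2 * ν ^ 2 * (N : ℝ) ^ 2) := by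
    linear_combination (4 * Real.pi ^ 2 * ν ^ 2 * (N : ℝ) ^ 2) *
      Real.sq_sqrt (show (0 : ℝ) ≤ 3 by norm_num)
  rw [mult, le_inv_comm₀ (by norm_num) (by positivity)]
  norm_num
  linarith

/-- There is an absolute constant `N₁ > 0` such that for every `ν > 0` and
every integer `N` with `N₁ ≤ N ≤ 1/(2√3 π ν)`, both `‖K_N‖_{L¹(𝕋)}` and `‖K_{>N}‖_{L¹(𝕋)}`
are comparable to `log N` with absolute constants `c₁, c₂ > 0`. -/
theorem statement10 :
    ∃ N₁ : ℕ, 0 < N₁ ∧ ∃ c₁ c₂ : ℝ, 0 < c₁ ∧ 0 < c₂ ∧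
      ∀ ν : ℝ, 0 < ν → ∀ N : ℕ, N₁ ≤ N →
        (N : ℝ) ≤ 1 / (2 * Real.sqrt 3 * Real.pi * ν) →
          (c₁ * Real.log N ≤ ∫ x in Set.Ico (0 : ℝ) 1, ‖KNker ν N x‖ ∧
            (∫ x in Set.Ico (0 : ℝ) 1, ‖KNker ν N x‖) ≤ c₂ * Real.log N) ∧
          ∃ K : ℝ → ℂ,
            IntegrableOn K (Set.Ico (0 : ℝ) 1) ∧
            (∀ x : ℝ, K (x + 1) = K x) ∧
            (∀ k : ℤ, (N : ℤ) < |k| →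
              (∫ x in Set.Ico (0 : ℝ) 1, K x * e1 (-(k : ℝ) * x))
                = (((1 + 4 * Real.pi ^ 2 * ν ^ 2 * (k : ℝ) ^ 2)⁻¹ : ℝ) : ℂ)) ∧
            (∀ k : ℤ, |k| ≤ (N : ℤ) →
              (∫ x in Set.Ico (0 : ℝ) 1, K x * e1 (-(k : ℝ) * x)) = 0) ∧
            c₁ * Real.log N ≤ ∫ x in Set.Ico (0 : ℝ) 1, ‖K x‖ ∧
            (∫ x in Set.Ico (0 : ℝ) 1, ‖K x‖) ≤ c₂ * Real.log N := by
  refine ⟨3 ^ 10, by norm_num, 1 / 10, 7, by norm_num, by norm_num, fun ν hν N hN hνN => ?_⟩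
  have hN' : (3 : ℝ) ^ 10 ≤ N := by exact_mod_cast hN
  have hlog : 10 ≤ Real.log N := by
    rw [Real.le_log_iff_exp_le (by linarith), show (10 : ℝ) = (10 : ℕ) * 1 by norm_num,
      Real.exp_nat_mul]
    refine le_trans ?_ hN'
    gcongr
    linarith [Real.exp_one_lt_d9]
  have hup : ∫ x in Set.Ico (0 : ℝ) 1, ‖KNker ν N x‖ ≤ 6 * Real.log N := by
    rw [setIntegral_Ico_eq]
    refine (integral_norm_KNker_le ν N).trans ?_
    have h3 : (3 : ℝ) ≤ N := by linarith
    have h : Real.log (4 * N + 3) ≤ Real.log ((N : ℝ) ^ 3) := by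
      refine Real.log_le_log (by positivity) ?_
      have : (9 : ℝ) * N ≤ N ^ 3 := by
        nlinarith [mul_nonneg (mul_nonneg (by linarith : (0 : ℝ) ≤ N) (sub_nonneg.2 h3))
          (by linarith : (0 : ℝ) ≤ N + 3)]
      linarith
    rw [Real.log_pow] at h
    push_cast at h
    linarith
  have hlow : 1 / 5 * Real.log N ≤ ∫ x in Set.Ico (0 : ℝ) 1, ‖KNker ν N x‖ := by
    rw [setIntegral_Ico_eq]
    refine le_trans ?_ (le_integral_norm_KNker
      (fun k hk => three_quarters_le_mult hν hνN hk) (by norm_num))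
    have h : 4 / 15 ≤ Real.pi⁻¹ := by
      rw [le_inv_comm₀ (by norm_num) Real.pi_pos]
      linarith [Real.pi_lt_d2]
    nlinarith
  have hKN : IntegrableOn (KNker ν N) (Set.Ico (0 : ℝ) 1) :=
    (continuous_KNker ν N).integrableOn_Icc.mono_set Set.Ico_subset_Icc_self
  have hF : IntegrableOn (fun x => (fullKer ν x : ℂ)) (Set.Ico (0 : ℝ) 1) :=
    (integrableOn_fullKer ν).ofReal
  have hcoeff : ∀ k : ℤ,
      ∫ x in Set.Ico (0 : ℝ) 1, ((fullKer ν x : ℂ) - KNker ν N x) * e1 (-(k : ℝ) * x)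
        = mult ν k - if |k| ≤ (N : ℤ) then (mult ν k : ℂ) else 0 := by
    intro k
    have hb : Continuous fun x : ℝ => e1 (-(k : ℝ) * x) := by fun_prop
    have hFe : IntegrableOn (fun x => (fullKer ν x : ℂ) * e1 (-(k : ℝ) * x))
        (Set.Ico (0 : ℝ) 1) :=
      Integrable.mul_bdd (c := 1) hF hb.aestronglyMeasurable (.of_forall fun x => (norm_e1 _).le)
    have hKe : IntegrableOn (fun x => KNker ν N x * e1 (-(k : ℝ) * x)) (Set.Ico (0 : ℝ) 1) :=
      Integrable.mul_bdd (c := 1) hKN hb.aestronglyMeasurable (.of_forall fun x => (norm_e1 _).le)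
    simp_rw [sub_mul]
    rw [integral_sub hFe hKe, integral_fullKer_mul_e1 hν, setIntegral_Ico_eq,
      integral_KNker_mul_e1]
  have hFn := integral_norm_fullKer hν
  refine ⟨⟨by linarith, by linarith⟩, fun x => (fullKer ν x : ℂ) - KNker ν N x, hF.sub hKN,
    fun x => ?_, fun k hk => ?_, fun k hk => ?_, ?_, ?_⟩
  · simp only [fullKer_add_one, KNker_add_one]
  · rw [hcoeff, if_neg (not_le.2 hk), sub_zero, mult]
  · rw [hcoeff, if_pos hk, sub_self]
  · have h := integral_mono hKN.norm (hF.norm.add (hF.sub hKN).norm) fun x =>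
      (norm_le_norm_add_norm_sub (fullKer ν x : ℂ) (KNker ν N x))
    rw [integral_add' hF.norm (hF.sub hKN).norm, hFn] at h
    simp only [Pi.sub_apply] at h
    linarith
  · have h := integral_mono (hF.sub hKN).norm (hF.norm.add hKN.norm) fun x =>
      (norm_sub_le (fullKer ν x : ℂ) (KNker ν N x))
    rw [integral_add' hF.norm hKN.norm, hFn] at h
    simp only [Pi.sub_apply] at h
    linarith

end
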